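/- arXiv:0903.1019 — 8 statements merged into one kernel-verified Lean document; each statement's English description precedes it below -/
import Mathlib

section
/- Let n > 1 and m ≥ 1 be integers. Suppose the sequence m+1, m+2, ..., m+n is a W sequence with W number m+r (for some 1 ≤ r ≤ n), and let p be the smallest prime factor of m+r. Then p ≥ (n+1)/2, i.e., 2p ≥ n+1. -/
theorem w_seq_min_fac (n m r : ℕ) (hn : 1 < n) (hm : 1 ≤ m)
    (hr1 : 1 ≤ r) (hrn : r ≤ n)
    (hW : ∀ j, 1 ≤ j → j ≤ n → j ≠ r → Nat.Coprime (m + r) (m + j)) :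
    n + 1 ≤ 2 * (m + r).minFac := by
  have hp : (m + r).minFac.Prime := Nat.minFac_prime (by omega)
  have hd : (m + r).minFac ∣ m + r := Nat.minFac_dvd _
  generalize (m + r).minFac = p at hp hd ⊢
  have hpos := hp.pos
  have key : ∀ j, 1 ≤ j → j ≤ n → j ≠ r → ¬ p ∣ m + j := fun j h1 h2 h3 h4 =>
    Nat.not_coprime_of_dvd_of_dvd hp.one_lt hd h4 (hW j h1 h2 h3)
  have hup : n < r + p := by
    by_contra h
    refine key (r + p) (by omega) (by omega) (by omega) ?_
    rw [← add_assoc]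
    exact Nat.dvd_add hd dvd_rfl
  have hlo : r ≤ p := by
    by_contra h
    refine key (r - p) (by omega) (by omega) (by omega) ?_
    rw [show m + (r - p) = m + r - p by omega]
    exact Nat.dvd_sub hd dvd_rfl
  omega
end

section
/- Let n > 1 and m ≥ 1 be integers. If there exists a prime p with m+1 ≤ p ≤ m+n, then the sequence m+1, m+2, ..., m+n is a W sequence; that is, there exists r with 1 ≤ r ≤ n such that m+r is coprime to m+j for every j ≠ r with 1 ≤ j ≤ n. -/
theorem prime_in_interval_implies_w_seq (n m : ℕ) (hn : 1 < n) (hm : 1 ≤ m)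
    (hp : ∃ p : ℕ, p.Prime ∧ m + 1 ≤ p ∧ p ≤ m + n) :
    ∃ r, 1 ≤ r ∧ r ≤ n ∧
      ∀ j, 1 ≤ j → j ≤ n → j ≠ r → Nat.Coprime (m + r) (m + j) := by
  obtain ⟨p₀, hp₀, h1, h2⟩ := hp
  -- `p` is the largest prime not exceeding `m + n`
  obtain ⟨p, hpdef⟩ : ∃ p, p = Nat.findGreatest Nat.Prime (m + n) := ⟨_, rfl⟩
  have hpp : p.Prime := hpdef ▸ Nat.findGreatest_spec h2 hp₀
  have hle : p ≤ m + n := hpdef ▸ Nat.findGreatest_le (m + n)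
  have hge : p₀ ≤ p := hpdef ▸ Nat.le_findGreatest h2 hp₀
  -- Bertrand's postulate
  obtain ⟨q, hq, hpq, hq2⟩ := Nat.exists_prime_lt_and_le_two_mul p hpp.ne_zero
  have hlt : m + n < 2 * p := by
    by_contra hcon
    have : q ≤ p := hpdef ▸ Nat.le_findGreatest (by omega) hq
    omega
  refine ⟨p - m, by omega, by omega, fun j hj1 hj2 hjr => ?_⟩
  have he : m + (p - m) = p := by omega
  rw [he, hpp.coprime_iff_not_dvd]
  rintro ⟨k, hk⟩
  rcases k with _ | _ | k
  · omega
  · omega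
  · have : p * (k + 1 + 1) = p * k + 2 * p := by ring
    omega
end

section
/- Let n > 1 and m ≥ 1 be integers, and let q be the largest prime with m < q ≤ m+n (assuming a prime exists in this range). Then q is coprime to every integer k with m+1 ≤ k ≤ m+n and k ≠ q; in particular q is a W number of the sequence m+1, ..., m+n. -/
theorem largest_prime_is_w_number (n m q : ℕ) (hn : 1 < n) (hm : 1 ≤ m)
    (hq : q.Prime) (hq1 : m < q) (hq2 : q ≤ m + n)
    (hmax : ∀ q' : ℕ, q'.Prime → m < q' → q' ≤ m + n → q' ≤ q) :
    ∀ k, m + 1 ≤ k → k ≤ m + n → k ≠ q → Nat.Coprime q k := by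
  intro k hk1 hk2 hkq
  rw [hq.coprime_iff_not_dvd]
  rintro ⟨c, rfl⟩
  obtain ⟨p, hp, hp1, hp2⟩ := Nat.exists_prime_lt_and_le_two_mul q hq.ne_zero
  have hc0 : c ≠ 0 := by
    rintro rfl
    omega
  have hc1 : c ≠ 1 := by
    rintro rfl
    omega
  have hc : 2 ≤ c := by omega
  have h2 : q * 2 ≤ q * c := Nat.mul_le_mul_left q hc
  have := hmax p hp (by omega) (by omega)
  omega
end

section
/- For every integer m ≥ 1: there exists a prime p with m² < p < (m+1)² if and only if the sequence m²+1, m²+2, ..., m²+2m is a W sequence. -/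
theorem prime_between_squares_iff_w_seq (m : ℕ) (hm : 1 ≤ m) :
    (∃ p : ℕ, p.Prime ∧ m ^ 2 < p ∧ p < (m + 1) ^ 2) ↔
      ∃ r, 1 ≤ r ∧ r ≤ 2 * m ∧
        ∀ j, 1 ≤ j → j ≤ 2 * m → j ≠ r →
          Nat.Coprime (m ^ 2 + r) (m ^ 2 + j) := by
  constructor
  · rintro ⟨p, hp, h1, h2⟩
    obtain ⟨r, rfl⟩ := Nat.exists_eq_add_of_lt h1
    refine ⟨r + 1, by omega, by nlinarith, ?_⟩
    have hr : r + 1 ≤ 2 * m := by nlinarith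
    intro j hj1 hj2 hne
    have hm2 : 2 * m ≤ m ^ 2 + 1 := by
      zify; nlinarith [sq_nonneg ((m : ℤ) - 1)]
    rw [← add_assoc, Nat.Prime.coprime_iff_not_dvd hp]
    intro hd
    rcases lt_or_gt_of_ne hne with h | h
    · have := Nat.le_of_dvd (by omega) hd
      omega
    · have h3 := Nat.dvd_sub hd (dvd_refl _)
      have := Nat.le_of_dvd (by omega) h3
      omega
  · rintro ⟨r, hr1, hr2, h⟩
    refine ⟨m ^ 2 + r, ?_, by omega, by nlinarith⟩
    by_contra hnp
    have hpos : 0 < m ^ 2 := by positivity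
    have hq := Nat.minFac_prime (n := m ^ 2 + r) (by omega)
    have hd := Nat.minFac_dvd (m ^ 2 + r)
    have hs := Nat.minFac_sq_le_self (n := m ^ 2 + r) (by omega) hnp
    generalize (m ^ 2 + r).minFac = q at hq hd hs
    have hqm : q ≤ m := by
      by_contra hc
      have : m + 1 ≤ q := by omega
      nlinarith
    have hq0 := hq.pos
    rcases le_or_gt r m with hr | hr
    · have hc := h (r + q) (by omega) (by omega) (by omega)
      refine Nat.not_coprime_of_dvd_of_dvd hq.one_lt hd ?_ hc
      rw [← add_assoc]
      exact dvd_add hd (dvd_refl q)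
    · have hc := h (r - q) (by omega) (by omega) (by omega)
      refine Nat.not_coprime_of_dvd_of_dvd hq.one_lt hd ?_ hc
      rw [← Nat.add_sub_assoc (by omega)]
      exact Nat.dvd_sub hd (dvd_refl q)
end

section
/- Let m ≥ 1 be an integer and suppose 1 ≤ r ≤ 2m is such that m²+r is coprime to m²+j for every j ≠ r with 1 ≤ j ≤ 2m. Then m²+r is prime. -/
theorem w_number_between_squares_is_prime (m r : ℕ) (hm : 1 ≤ m)
    (hr1 : 1 ≤ r) (hr2 : r ≤ 2 * m)
    (hW : ∀ j, 1 ≤ j → j ≤ 2 * m → j ≠ r →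
      Nat.Coprime (m ^ 2 + r) (m ^ 2 + j)) :
    (m ^ 2 + r).Prime := by
  by_contra hn
  have hsq := Nat.minFac_sq_le_self (n := m ^ 2 + r) (by omega) hn
  have hp : (m ^ 2 + r).minFac.Prime := Nat.minFac_prime (by nlinarith)
  have hd := Nat.minFac_dvd (m ^ 2 + r)
  generalize (m ^ 2 + r).minFac = p at hsq hp hd
  have hpos := hp.pos
  have hpm : p ≤ m := by
    by_contra h
    have : m + 1 ≤ p := by omega
    nlinarith
  by_cases h : r + p ≤ 2 * m
  · have hc := hW (r + p) (by omega) h (by omega)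
    have hd2 : p ∣ m ^ 2 + (r + p) := by
      rw [← add_assoc]
      exact dvd_add hd dvd_rfl
    exact Nat.not_coprime_of_dvd_of_dvd hp.one_lt hd hd2 hc
  · have hc := hW (r - p) (by omega) (by omega) (by omega)
    have hd2 : p ∣ m ^ 2 + (r - p) := by
      have h2 := Nat.dvd_sub hd (dvd_refl p)
      rwa [Nat.add_sub_assoc (by omega)] at h2
    exact Nat.not_coprime_of_dvd_of_dvd hp.one_lt hd hd2 hc
end

section
/- Let n > 1 and m ≥ 1 be integers with m+1 ≤ (⌈(n+1)/2⌉)² (more precisely, suppose m+n < ((n+1)/2)²·4/4, i.e., 4(m+n) < (n+1)²... stated cleanly: suppose every member of the sequence is less than ((n+1)/2)²). If 1 ≤ r ≤ n and m+r is coprime to m+j for every j ≠ r with 1 ≤ j ≤ n, and m+r < ((n+1)/2)², then m+r is prime. -/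
theorem small_w_number_is_prime (n m r : ℕ) (hn : 1 < n) (hm : 1 ≤ m)
    (hr1 : 1 ≤ r) (hr2 : r ≤ n)
    (hW : ∀ j, 1 ≤ j → j ≤ n → j ≠ r → Nat.Coprime (m + r) (m + j))
    (hsmall : 4 * (m + r) < (n + 1) ^ 2) :
    (m + r).Prime := by
  by_contra hnp
  have hsq := Nat.minFac_sq_le_self (n := m + r) (by omega) hnp
  have hp : (m + r).minFac.Prime := Nat.minFac_prime (by omega)
  have hd : (m + r).minFac ∣ m + r := Nat.minFac_dvd _
  generalize (m + r).minFac = p at hsq hp hd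
  have hpos := hp.pos
  have h1 : n < r + p := by
    by_contra h
    have hc := hW (r + p) (by omega) (by omega) (by omega)
    have hd2 : p ∣ m + (r + p) := by
      rw [← add_assoc]; exact dvd_add hd dvd_rfl
    exact Nat.not_coprime_of_dvd_of_dvd hp.one_lt hd hd2 hc
  have h2 : r ≤ p := by
    by_contra h
    have hc := hW (r - p) (by omega) (by omega) (by omega)
    have hd2 : p ∣ m + (r - p) := by
      rw [← Nat.add_sub_assoc (by omega)]; exact Nat.dvd_sub hd dvd_rfl
    exact Nat.not_coprime_of_dvd_of_dvd hp.one_lt hd hd2 hc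
  have h3 : n + 1 ≤ 2 * p := by omega
  nlinarith [Nat.pow_le_pow_left h3 2]
end

section
/- For every real ε > 0 there exists M such that for all integers m ≥ M: there exists a prime p with m < p ≤ m + m^{1/2+ε} if and only if the sequence m+1, m+2, ..., m+⌊m^{1/2+ε}⌋ is a W sequence. -/
theorem prime_aux (m n : ℕ) (hm : 1 ≤ m) (h : 4 * (m + n) < (n + 1) ^ 2) (hn : 2 ≤ n) :
    (∃ p : ℕ, p.Prime ∧ m < p ∧ p ≤ m + n) ↔
        ∃ r, 1 ≤ r ∧ r ≤ n ∧
          ∀ j, 1 ≤ j → j ≤ n → j ≠ r → Nat.Coprime (m + r) (m + j) := by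
  constructor
  · intro hp
    have key : ∃ p : ℕ, p.Prime ∧ m < p ∧ p ≤ m + n ∧ m + n < 2 * p := by
      by_cases hnm : n < m
      · obtain ⟨p, hp, h1, h2⟩ := hp
        exact ⟨p, hp, h1, h2, by omega⟩
      · obtain ⟨q, hq, h1, h2⟩ := Nat.exists_prime_lt_and_le_two_mul ((m + n) / 2) (by omega)
        exact ⟨q, hq, by omega, by omega, by omega⟩
    obtain ⟨p, hp, h1, h2, h3⟩ := key
    refine ⟨p - m, by omega, by omega, fun j hj1 hj2 hj => ?_⟩
    rw [show m + (p - m) = p by omega, hp.coprime_iff_not_dvd]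
    rintro ⟨k, hk⟩
    have : k < 2 := by
      by_contra hk2
      have : p * 2 ≤ p * k := Nat.mul_le_mul_left _ (by omega)
      omega
    interval_cases k <;> omega
  · rintro ⟨r, hr1, hr2, hr⟩
    refine ⟨m + r, ?_, by omega, by omega⟩
    by_contra hnp
    have hq : (m + r).minFac.Prime := Nat.minFac_prime (by omega)
    have hd := Nat.minFac_dvd (m + r)
    have hsq := Nat.minFac_sq_le_self (by omega : 0 < m + r) hnp
    generalize (m + r).minFac = q at *
    have hq2 := hq.two_le
    have bad : ∀ j, 1 ≤ j → j ≤ n → j ≠ r → ¬ q ∣ m + j := fun j h1 h2 h3 h4 =>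
      Nat.not_coprime_of_dvd_of_dvd hq.one_lt hd h4 (hr j h1 h2 h3)
    have hA : n < r + q := by
      by_contra hc
      exact bad (r + q) (by omega) (by omega) (by omega) (by
        rw [← add_assoc]; exact dvd_add hd dvd_rfl)
    have hB : r ≤ q := by
      by_contra hc
      refine bad (r - q) (by omega) (by omega) (by omega) ?_
      rw [show m + (r - q) = m + r - q by omega]
      exact Nat.dvd_sub hd dvd_rfl
    have : n + 1 ≤ 2 * q := by omega
    nlinarith [Nat.mul_le_mul this this]

theorem prime_in_short_interval_iff_w_seq (ε : ℝ) (hε : 0 < ε) :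
    ∃ M : ℕ, ∀ m : ℕ, M ≤ m →
      ((∃ p : ℕ, p.Prime ∧ m < p ∧ (p : ℝ) ≤ (m : ℝ) + (m : ℝ) ^ ((1 : ℝ) / 2 + ε)) ↔
        ∃ r, 1 ≤ r ∧ r ≤ ⌊(m : ℝ) ^ ((1 : ℝ) / 2 + ε)⌋₊ ∧
          ∀ j, 1 ≤ j → j ≤ ⌊(m : ℝ) ^ ((1 : ℝ) / 2 + ε)⌋₊ → j ≠ r →
            Nat.Coprime (m + r) (m + j)) := by
  have t1 := ((tendsto_rpow_atTop (by positivity : 0 < (1 : ℝ) / 2 + ε)).comp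
    (tendsto_natCast_atTop_atTop (R := ℝ))).eventually_ge_atTop 8
  have t2 := ((tendsto_rpow_atTop (by positivity : 0 < 2 * ε)).comp
    (tendsto_natCast_atTop_atTop (R := ℝ))).eventually_ge_atTop 8
  obtain ⟨M, hM⟩ := Filter.eventually_atTop.1 ((t1.and t2).and (Filter.eventually_ge_atTop 1))
  refine ⟨M, fun m hm => ?_⟩
  obtain ⟨⟨h1, h2⟩, h3⟩ := hM m hm
  simp only [Function.comp] at h1 h2
  have hmpos : (0 : ℝ) < m := by exact_mod_cast h3
  have hx : ((m : ℝ) ^ ((1 : ℝ) / 2 + ε)) ^ 2 = m * (m : ℝ) ^ (2 * ε) := by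
    rw [← Real.rpow_natCast, ← Real.rpow_mul hmpos.le, ← Real.rpow_one_add' hmpos.le (by positivity)]
    congr 1
    push_cast
    ring
  generalize (m : ℝ) ^ ((1 : ℝ) / 2 + ε) = x at *
  have hf := Nat.floor_le (by linarith : 0 ≤ x)
  have hl := Nat.lt_floor_add_one x
  rw [← prime_aux m ⌊x⌋₊ h3 ?_ (Nat.le_floor (by push_cast; linarith))]
  · refine exists_congr fun p => and_congr_right fun _ => and_congr_right fun hp => ?_
    rw [← Nat.sub_le_iff_le_add', Nat.le_floor_iff (by linarith), Nat.cast_sub hp.le]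
    constructor <;> intro <;> linarith
  · have : (4 * ((m : ℝ) + ⌊x⌋₊)) < ((⌊x⌋₊ : ℝ) + 1) ^ 2 := by
      have a : x ^ 2 < ((⌊x⌋₊ : ℝ) + 1) ^ 2 := by gcongr
      have b : 8 * (m : ℝ) ≤ x ^ 2 := by rw [hx]; nlinarith
      nlinarith
    exact_mod_cast this
end

section
/- Let m > 1 and n > 1 be integers, and let f_k denote the k-th Fibonacci number (f_1 = f_2 = 1, f_{k+2} = f_{k+1} + f_k). If some member of the sequence f_{m+1}, f_{m+2}, ..., f_{m+n} is prime, then this sequence is a W sequence; that is, there exists r with 1 ≤ r ≤ n such that f_{m+r} is coprime to f_{m+j} for every j ≠ r with 1 ≤ j ≤ n. -/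
lemma eq_two_of_proper_dvd {a k : ℕ} (ha : 2 ≤ a) (hak : a < k) (hd : a ∣ k)
    (hp : (Nat.fib k).Prime) : a = 2 := by
  by_contra hne
  have h3 : 3 ≤ a := by omega
  have h1 : Nat.fib 3 ≤ Nat.fib a := Nat.fib_mono h3
  have h2 : Nat.fib a < Nat.fib k := (Nat.fib_lt_fib ha).2 hak
  have h3' : Nat.fib 3 = 2 := rfl
  rcases (Nat.dvd_prime hp).1 (Nat.fib_dvd a k hd) with h | h <;> omega

lemma prime_or_four {k : ℕ} (hk : 2 ≤ k) (hp : (Nat.fib k).Prime) : k.Prime ∨ k = 4 := by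
  by_cases h : k.Prime
  · exact Or.inl h
  right
  obtain ⟨a, hd, ha2, hak⟩ := Nat.exists_dvd_of_not_prime2 hk h
  have ha := eq_two_of_proper_dvd ha2 hak hd hp
  obtain ⟨b, rfl⟩ := hd
  subst ha
  have hb := eq_two_of_proper_dvd (a := b) (by omega) (by omega) (Dvd.intro_left 2 rfl) hp
  omega

theorem fib_prime_implies_w_seq (m n : ℕ) (hm : 1 < m) (hn : 1 < n)
    (hp : ∃ k, m + 1 ≤ k ∧ k ≤ m + n ∧ (Nat.fib k).Prime) :
    ∃ r, 1 ≤ r ∧ r ≤ n ∧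
      ∀ j, 1 ≤ j → j ≤ n → j ≠ r →
        Nat.Coprime (Nat.fib (m + r)) (Nat.fib (m + j)) := by
  obtain ⟨k, hk1, hk2, hkp⟩ := hp
  have hq : ∃ q, m + 1 ≤ q ∧ q ≤ m + n ∧ q.Prime := by
    rcases prime_or_four (by omega) hkp with h | h
    · exact ⟨k, hk1, hk2, h⟩
    · by_cases h5 : 5 ≤ m + n
      · exact ⟨5, by omega, h5, by norm_num⟩
      · exact ⟨3, by omega, by omega, by norm_num⟩
  obtain ⟨q, hq1, hq2, hqp⟩ := hq
  have hqle := Nat.le_findGreatest (P := Nat.Prime) hq2 hqp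
  have hpp := Nat.findGreatest_spec (P := Nat.Prime) hq2 hqp
  have hple := Nat.findGreatest_le (P := Nat.Prime) (m + n)
  have hmax : ∀ x, x ≤ m + n → x.Prime → x ≤ Nat.findGreatest Nat.Prime (m + n) :=
    fun x h1 h2 => Nat.le_findGreatest h1 h2
  generalize Nat.findGreatest Nat.Prime (m + n) = p at *
  have hbig : m + n < 2 * p := by
    by_contra hle
    obtain ⟨x, hx, h1, h2⟩ := Nat.exists_prime_lt_and_le_two_mul p hpp.ne_zero
    have := hmax x (by omega) hx
    omega
  refine ⟨p - m, by omega, by omega, fun j hj1 hj2 hj => ?_⟩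
  have e : m + (p - m) = p := by omega
  rw [e, Nat.Coprime, ← Nat.fib_gcd]
  have hc : Nat.Coprime p (m + j) := by
    rw [Nat.Prime.coprime_iff_not_dvd hpp]
    rintro ⟨c, hc⟩
    have : c < 2 := by
      by_contra h
      have := Nat.mul_le_mul_left p (show 2 ≤ c by omega)
      omega
    interval_cases c <;> omega
  rw [hc]
  rfl
end
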